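/- One-sided Hoeffding PAC-Bayes inequality: Let μ be any probability distribution on 𝒜 (independent of H^t) and let ε ∈ (0,1] satisfy π_n(a) ≥ ε almost surely for all a ∈ 𝒜 and all n ∈ {1,…,t}. Then for any λ > 0 and any δ ∈ (0,1), with probability at least 1 − δ over the draw of H^t, simultaneously for all probability distributions π on 𝒜 (including ones chosen as a function of H^t): r̂^IS(π, H^t) − r̄(π) ≤ (KL(π‖μ) + ln(1/δ))/λ + λ/(8 t ε²). -/

import Mathlib

open MeasureTheory Real

namespace OfflineBandits

/-- The σ-algebra generated by the history `H^n = (A_1, R_1, …, A_n, R_n)`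
(trivial for `n = 0`). -/
def hist {Ω 𝒜 : Type*} [MeasurableSpace 𝒜] (A : ℕ → Ω → 𝒜) (R : ℕ → Ω → ℝ)
    (n : ℕ) : MeasurableSpace Ω :=
  MeasurableSpace.comap (fun ω => fun i : Fin n => (A (i.1 + 1) ω, R (i.1 + 1) ω)) inferInstance

/-- `p` is a probability mass function on the finite action set `𝒜`. -/
def IsPMF {𝒜 : Type*} [Fintype 𝒜] (p : 𝒜 → ℝ) : Prop :=
  (∀ a, 0 ≤ p a) ∧ ∑ a, p a = 1

/-- Relative entropy (KL divergence) between two pmfs on a finite set. -/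
noncomputable def KL {𝒜 : Type*} [Fintype 𝒜] (p q : 𝒜 → ℝ) : ℝ :=
  ∑ a, p a * Real.log (p a / q a)

/-- Importance-sampling estimate `r̂^IS(a, H^t)` of the expected reward of action `a`. -/
noncomputable def rIS {Ω 𝒜 : Type*} [DecidableEq 𝒜] (A : ℕ → Ω → 𝒜) (R : ℕ → Ω → ℝ)
    (pol : ℕ → Ω → 𝒜 → ℝ) (t : ℕ) (a : 𝒜) (ω : Ω) : ℝ :=
  (t : ℝ)⁻¹ * ∑ n ∈ Finset.Icc 1 t, (if A n ω = a then 1 else 0) / pol n ω (A n ω) * R n ω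

/-- Importance-sampling estimate `r̂^IS(π, H^t)` of the expected reward of a policy. -/
noncomputable def rISPol {Ω 𝒜 : Type*} [Fintype 𝒜] [DecidableEq 𝒜] (A : ℕ → Ω → 𝒜) (R : ℕ → Ω → ℝ)
    (pol : ℕ → Ω → 𝒜 → ℝ) (t : ℕ) (p : 𝒜 → ℝ) (ω : Ω) : ℝ :=
  ∑ a, p a * rIS A R pol t a ω

/-- Expected reward `r̄(π)` of a policy `π`. -/
def rPol {𝒜 : Type*} [Fintype 𝒜] (rbar : 𝒜 → ℝ) (p : 𝒜 → ℝ) : ℝ :=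
  ∑ a, p a * rbar a

/-- The martingale difference `Z_n^IS(a)`. -/
noncomputable def Zis {Ω 𝒜 : Type*} [DecidableEq 𝒜] (A : ℕ → Ω → 𝒜) (R : ℕ → Ω → ℝ)
    (pol : ℕ → Ω → 𝒜 → ℝ) (rbar : 𝒜 → ℝ) (a : 𝒜) (n : ℕ) (ω : Ω) : ℝ :=
  (if A n ω = a then 1 else 0) / pol n ω (A n ω) * R n ω - rbar a

/-- The cumulative conditional variance `V_t^IS(a)` of the IS martingale. -/
noncomputable def Vis {Ω 𝒜 : Type*} [MeasurableSpace Ω] [MeasurableSpace 𝒜] [DecidableEq 𝒜]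
    (P : Measure Ω) (A : ℕ → Ω → 𝒜) (R : ℕ → Ω → ℝ)
    (pol : ℕ → Ω → 𝒜 → ℝ) (rbar : 𝒜 → ℝ) (t : ℕ) (a : 𝒜) (ω : Ω) : ℝ :=
  ∑ n ∈ Finset.Icc 1 t, (P[fun ω' => (Zis A R pol rbar a n ω') ^ 2 | hist A R (n - 1)]) ω

lemma bern_hoeffding (p h : ℝ) (hp0 : 0 ≤ p) (hp1 : p ≤ 1) :
    1 - p + p * Real.exp h ≤ Real.exp (h * p + h ^ 2 / 8) := by
  let ν : Measure ℝ := ENNReal.ofReal (1 - p) • Measure.dirac 0 + ENNReal.ofReal p • Measure.dirac 1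
  have hν : IsProbabilityMeasure ν := ⟨by
    simp only [ν, Measure.add_apply, Measure.smul_apply, smul_eq_mul, measure_univ, mul_one]
    rw [← ENNReal.ofReal_add (by linarith) hp0]; simp⟩
  have hint : ∀ f : ℝ → ℝ, ∫ x, f x ∂ν = (1 - p) * f 0 + p * f 1 := by
    intro f
    have h1 : Integrable f (ENNReal.ofReal (1 - p) • Measure.dirac (0 : ℝ)) :=
      (integrable_dirac (by simp)).smul_measure ENNReal.ofReal_ne_top
    have h2 : Integrable f (ENNReal.ofReal p • Measure.dirac (1 : ℝ)) :=
      (integrable_dirac (by simp)).smul_measure ENNReal.ofReal_ne_top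
    rw [integral_add_measure h1 h2, integral_smul_measure, integral_smul_measure]
    simp [ENNReal.toReal_ofReal, hp0, hp1]
  have hb : ∀ᵐ x ∂ν, (id x : ℝ) ∈ Set.Icc (0 : ℝ) 1 := by
    have : ν (Set.Icc (0 : ℝ) 1)ᶜ = 0 := by
      simp [ν]
    exact this
  have hsub := ProbabilityTheory.hasSubgaussianMGF_of_mem_Icc (μ := ν) (X := id) measurable_id.aemeasurable hb
  have := hsub.mgf_le h
  simp only [ProbabilityTheory.mgf, hint, id] at this
  have e1 : Real.exp (h * p + h ^ 2 / 8) = Real.exp (h * p) * Real.exp (h ^ 2 / 8) := Real.exp_add _ _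
  have e2 : (1 - p) * Real.exp (h * (0 - ((1 - p) * 0 + p * 1))) = (1 - p) * Real.exp (-(h*p)) := by
    ring_nf
  have e3 : p * Real.exp (h * (1 - ((1 - p) * 0 + p * 1))) = p * (Real.exp h * Real.exp (-(h*p))) := by
    rw [← Real.exp_add]; ring_nf
  rw [e2, e3] at this
  have e4 : (((‖(1:ℝ) - 0‖₊ / 2) ^ 2 : NNReal) : ℝ) * h ^ 2 / 2 = h ^ 2 / 8 := by
    simp; ring
  rw [e4] at this
  have e5 : Real.exp (h*p) * Real.exp (-(h*p)) = 1 := by rw [← Real.exp_add]; simp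
  rw [e1]
  calc 1 - p + p * Real.exp h = Real.exp (h*p) * ((1 - p) * Real.exp (-(h*p)) + p * (Real.exp h * Real.exp (-(h*p)))) := by
        linear_combination (-(1 - p + p * Real.exp h)) * e5
    _ ≤ _ := by gcongr

lemma chord (ε s x : ℝ) (hε : 0 < ε) (hx0 : 0 ≤ x) (hx1 : x ≤ ε⁻¹) :
    Real.exp (s * x) ≤ 1 + x * (ε * (Real.exp (s / ε) - 1)) := by
  have h1 : ε * x ≤ 1 := by
    calc ε * x ≤ ε * ε⁻¹ := by gcongr
      _ = 1 := mul_inv_cancel₀ hε.ne'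
  have := convexOn_exp.2 (Set.mem_univ (0 : ℝ)) (Set.mem_univ (s / ε))
    (by linarith : 0 ≤ 1 - ε * x) (by positivity : 0 ≤ ε * x) (by ring)
  simp only [smul_eq_mul, mul_zero, zero_add, Real.exp_zero] at this
  have e : ε * x * (s / ε) = s * x := by field_simp
  rw [e] at this
  linarith

lemma integral_mul_cond {Ω : Type*} {m m0 : MeasurableSpace Ω} (P : Measure Ω)
    [IsProbabilityMeasure P] (hm : m ≤ m0) (f g h : Ω → ℝ) (hf : Measurable[m] f) (C : ℝ)
    (hC : ∀ ω, |f ω| ≤ C) (hg : Integrable g P) (hgh : P[g | m] =ᵐ[P] h) :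
    ∫ ω, f ω * g ω ∂P = ∫ ω, f ω * h ω ∂P := by
  have hfg : Integrable (f * g) P :=
    hg.bdd_mul (hf.mono hm le_rfl).aestronglyMeasurable (c := C) (Filter.Eventually.of_forall hC)
  have h1 := condExp_mul_of_stronglyMeasurable_left (μ := P) hf.stronglyMeasurable hfg hg
  calc ∫ ω, f ω * g ω ∂P = ∫ ω, (P[f * g | m]) ω ∂P := (integral_condExp hm).symm
    _ = _ := by
      refine integral_congr_ae ?_
      filter_upwards [h1, hgh] with ω h1 h2
      rw [h1, Pi.mul_apply, h2]

lemma hist_le {Ω 𝒜 : Type*} [MeasurableSpace Ω] [MeasurableSpace 𝒜] (A : ℕ → Ω → 𝒜) (R : ℕ → Ω → ℝ)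
    (hA : ∀ n, Measurable (A n)) (hR : ∀ n, Measurable (R n)) (n : ℕ) :
    hist A R n ≤ ‹MeasurableSpace Ω› := by
  refine Measurable.comap_le ?_
  exact measurable_pi_lambda _ fun i => (hA _).prodMk (hR _)

lemma hist_pair {Ω 𝒜 : Type*} [MeasurableSpace 𝒜] (A : ℕ → Ω → 𝒜) (R : ℕ → Ω → ℝ)
    (n k : ℕ) (hk1 : 1 ≤ k) (hkn : k ≤ n) :
    Measurable[hist A R n] (fun ω => (A k ω, R k ω)) := by
  have h1 : Measurable[hist A R n] (fun ω => fun i : Fin n => (A (i.1 + 1) ω, R (i.1 + 1) ω)) :=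
    comap_measurable _
  have h2 := (measurable_pi_apply (X := fun _ : Fin n => 𝒜 × ℝ) (⟨k - 1, by omega⟩ : Fin n)).comp h1
  have e : k - 1 + 1 = k := by omega
  simpa [Function.comp_def, e] using h2

lemma hist_mono {Ω 𝒜 : Type*} [MeasurableSpace 𝒜] (A : ℕ → Ω → 𝒜) (R : ℕ → Ω → ℝ)
    {k n : ℕ} (hkn : k ≤ n) : hist A R k ≤ hist A R n := by
  refine Measurable.comap_le ?_
  exact @measurable_pi_lambda _ _ _ (hist A R n) _ _ fun i =>
    hist_pair A R n (i.1 + 1) (by omega) (by omega)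

lemma donsker {𝒜 : Type*} [Fintype 𝒜] (p μ f : 𝒜 → ℝ) (hp : IsPMF p) (hμ : IsPMF μ)
    (hac : ∀ a, μ a = 0 → p a = 0) :
    ∑ a, p a * f a ≤ KL p μ + Real.log (∑ a, μ a * Real.exp (f a)) := by
  set S := ∑ a, μ a * Real.exp (f a) with hS
  have hSnn : 0 ≤ S := Finset.sum_nonneg fun a _ => mul_nonneg (hμ.1 a) (Real.exp_pos _).le
  have hSpos : 0 < S := by
    rcases hSnn.lt_or_eq with h | h
    · exact h
    · exfalso
      have h0 := (Finset.sum_eq_zero_iff_of_nonneg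
        (fun a _ => mul_nonneg (hμ.1 a) (Real.exp_pos (f a)).le)).1 h.symm
      have : ∑ a, μ a = 0 := Finset.sum_eq_zero fun a ha => by
        have := h0 a ha
        simpa [(Real.exp_pos (f a)).ne'] using this
      rw [hμ.2] at this
      exact one_ne_zero this
  have key : ∀ a, p a * f a - p a * Real.log (p a / μ a) - p a * Real.log S
      ≤ μ a * Real.exp (f a) / S - p a := by
    intro a
    have hnn : 0 ≤ μ a * Real.exp (f a) / S :=
      div_nonneg (mul_nonneg (hμ.1 a) (Real.exp_pos _).le) hSnn
    rcases (hp.1 a).lt_or_eq with hpa | hpa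
    · have hμa : 0 < μ a := lt_of_le_of_ne (hμ.1 a) fun h => hpa.ne' (hac a h.symm)
      have hx : 0 < μ a * Real.exp (f a) / (p a * S) := by positivity
      have hlog := Real.log_le_sub_one_of_pos hx
      rw [Real.log_div (by positivity) (by positivity), Real.log_mul hμa.ne' (by positivity),
        Real.log_exp, Real.log_mul hpa.ne' hSpos.ne'] at hlog
      rw [Real.log_div hpa.ne' hμa.ne']
      have := mul_le_mul_of_nonneg_left hlog hpa.le
      have e : p a * (μ a * Real.exp (f a) / (p a * S) - 1) = μ a * Real.exp (f a) / S - p a := by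
        field_simp
      rw [e] at this
      linarith
    · rw [← hpa]; simpa using hnn
  have := Finset.sum_le_sum fun a (_ : a ∈ Finset.univ) => key a
  simp only [Finset.sum_sub_distrib, ← Finset.sum_mul, ← Finset.sum_div, hp.2, ← hS,
    div_self hSpos.ne'] at this
  unfold KL
  linarith

/-- Truncated importance-weighted reward. -/
noncomputable def Xtr {Ω 𝒜 : Type*} [DecidableEq 𝒜] (A : ℕ → Ω → 𝒜) (R : ℕ → Ω → ℝ)
    (pol : ℕ → Ω → 𝒜 → ℝ) (ε : ℝ) (a : 𝒜) (n : ℕ) (ω : Ω) : ℝ :=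
  (if A n ω = a then 1 else 0) / max ε (pol n ω a) * R n ω

section
variable {Ω 𝒜 : Type*} [DecidableEq 𝒜] (A : ℕ → Ω → 𝒜) (R : ℕ → Ω → ℝ)
    (pol : ℕ → Ω → 𝒜 → ℝ) (ε : ℝ)

lemma Xtr_nonneg (hε : 0 < ε) (hR01 : ∀ n ω, R n ω ∈ Set.Icc (0 : ℝ) 1) (a : 𝒜) (n : ℕ) (ω : Ω) :
    0 ≤ Xtr A R pol ε a n ω := by
  unfold Xtr
  have := (hR01 n ω).1
  have : 0 < max ε (pol n ω a) := lt_max_of_lt_left hε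
  split_ifs <;> positivity

lemma Xtr_le (hε : 0 < ε) (hR01 : ∀ n ω, R n ω ∈ Set.Icc (0 : ℝ) 1) (a : 𝒜) (n : ℕ) (ω : Ω) :
    Xtr A R pol ε a n ω ≤ ε⁻¹ := by
  unfold Xtr
  have h0 := (hR01 n ω).1
  have h1 := (hR01 n ω).2
  have h2 : (max ε (pol n ω a))⁻¹ ≤ ε⁻¹ := by
    gcongr; exact le_max_left _ _
  have h3 : 0 < max ε (pol n ω a) := lt_max_of_lt_left hε
  split_ifs
  · calc 1 / max ε (pol n ω a) * R n ω ≤ 1 / max ε (pol n ω a) * 1 := by gcongr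
      _ ≤ _ := by simpa using h2
  · simp [hε.le]

lemma Xtr_meas [MeasurableSpace 𝒜] [MeasurableSingletonClass 𝒜]
    (hpolMeas : ∀ n a, Measurable[hist A R (n - 1)] (fun ω => pol n ω a))
    (a : 𝒜) (n k : ℕ) (h1 : 1 ≤ n) (hnk : n ≤ k) :
    Measurable[hist A R k] (Xtr A R pol ε a n) := by
  have hp := hist_pair A R k n h1 hnk
  have hq : Measurable[hist A R k] (fun ω => pol n ω a) :=
    (hpolMeas n a).mono (hist_mono A R (by omega)) le_rfl
  have hA : Measurable[hist A R k] (A n) := measurable_fst.comp hp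
  have hR : Measurable[hist A R k] (R n) := measurable_snd.comp hp
  letI := hist A R k
  have hI : Measurable (fun ω => if A n ω = a then (1 : ℝ) else 0) :=
    Measurable.ite (hA (measurableSet_singleton a)) measurable_const measurable_const
  exact (hI.div (measurable_const.max hq)).mul hR

end

lemma one_step
    {Ω 𝒜 : Type*} [MeasurableSpace Ω] [Fintype 𝒜] [DecidableEq 𝒜]
    [MeasurableSpace 𝒜] [MeasurableSingletonClass 𝒜]
    (P : Measure Ω) [IsProbabilityMeasure P]
    (A : ℕ → Ω → 𝒜) (R : ℕ → Ω → ℝ)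
    (hA : ∀ n, Measurable (A n)) (hR : ∀ n, Measurable (R n))
    (hR01 : ∀ n ω, R n ω ∈ Set.Icc (0 : ℝ) 1)
    (pol : ℕ → Ω → 𝒜 → ℝ)
    (hpolMeas : ∀ n a, Measurable[hist A R (n - 1)] (fun ω => pol n ω a))
    (n : ℕ) (a : 𝒜)
    (hpolCond : (P[(fun ω => if A n ω = a then (1 : ℝ) else 0) | hist A R (n - 1)])
        =ᵐ[P] fun ω => pol n ω a)
    (rbar : 𝒜 → ℝ)
    (hrew : (P[R n | hist A R (n - 1) ⊔ MeasurableSpace.comap (A n) inferInstance])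
        =ᵐ[P] fun ω => rbar (A n ω))
    (ε : ℝ) (hε0 : 0 < ε)
    (hεpol : ∀ᵐ ω ∂P, ε ≤ pol n ω a)
    (W : Ω → ℝ) (hW : Measurable[hist A R (n - 1)] W) (C : ℝ) (hC : ∀ ω, |W ω| ≤ C) :
    ∫ ω, W ω * Xtr A R pol ε a n ω ∂P = rbar a * ∫ ω, W ω ∂P := by
  have hle := hist_le A R hA hR (n - 1)
  have hle2 : hist A R (n - 1) ⊔ MeasurableSpace.comap (A n) inferInstance ≤ ‹MeasurableSpace Ω› :=
    sup_le hle (hA n).comap_le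
  have hWq : Measurable[hist A R (n - 1)] (fun ω => W ω / max ε (pol n ω a)) := by
    have hq := hpolMeas n a
    letI := hist A R (n - 1)
    exact hW.div (measurable_const.max hq)
  have hbd : ∀ ω, |W ω / max ε (pol n ω a)| ≤ C / ε := by
    intro ω
    have h3 : 0 < max ε (pol n ω a) := lt_max_of_lt_left hε0
    have hC0 : 0 ≤ C := (abs_nonneg _).trans (hC ω)
    rw [abs_div, abs_of_pos h3]
    exact div_le_div₀ hC0 (hC ω) hε0 (le_max_left _ _)
  have hI : Measurable[hist A R (n - 1) ⊔ MeasurableSpace.comap (A n) inferInstance]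
      (fun ω => if A n ω = a then (1 : ℝ) else 0) := by
    have h1 : Measurable[hist A R (n - 1) ⊔ MeasurableSpace.comap (A n) inferInstance] (A n) :=
      (comap_measurable (A n)).mono le_sup_right le_rfl
    letI := hist A R (n - 1) ⊔ MeasurableSpace.comap (A n) inferInstance
    exact Measurable.ite (h1 (measurableSet_singleton a)) measurable_const measurable_const
  have hWqI : Measurable[hist A R (n - 1) ⊔ MeasurableSpace.comap (A n) inferInstance]
      (fun ω => W ω / max ε (pol n ω a) * if A n ω = a then (1 : ℝ) else 0) := by
    have h1 := hWq.mono (le_sup_left (b := MeasurableSpace.comap (A n) inferInstance)) le_rfl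
    letI := hist A R (n - 1) ⊔ MeasurableSpace.comap (A n) inferInstance
    exact h1.mul hI
  have hIint : Integrable (fun ω => if A n ω = a then (1 : ℝ) else 0) P :=
    Integrable.of_bound (hI.mono hle2 le_rfl).aestronglyMeasurable 1
      (Filter.Eventually.of_forall fun ω => by split_ifs <;> simp)
  have hRint : Integrable (R n) P :=
    Integrable.of_bound (hR n).aestronglyMeasurable 1
      (Filter.Eventually.of_forall fun ω => by
        rw [Real.norm_eq_abs, abs_of_nonneg (hR01 n ω).1]; exact (hR01 n ω).2)
  have s1 := integral_mul_cond P hle2 _ (R n) _ hWqI (C / ε) (fun ω => by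
    split_ifs
    · simpa using hbd ω
    · simpa using (abs_nonneg _).trans (hbd ω)) hRint hrew
  have s2 := integral_mul_cond P hle _ _ _ hWq (C / ε) hbd hIint hpolCond
  calc ∫ ω, W ω * Xtr A R pol ε a n ω ∂P
      = ∫ ω, (W ω / max ε (pol n ω a) * if A n ω = a then (1 : ℝ) else 0) * R n ω ∂P := by
        congr 1; ext ω; unfold Xtr; ring
    _ = _ := s1
    _ = ∫ ω, rbar a * (W ω / max ε (pol n ω a) * if A n ω = a then (1 : ℝ) else 0) ∂P := by
        congr 1; ext ω
        split_ifs with h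
        · rw [h]; ring
        · simp
    _ = rbar a * ∫ ω, W ω / max ε (pol n ω a) * pol n ω a ∂P := by
        rw [integral_const_mul, s2]
    _ = _ := by
        congr 1
        refine integral_congr_ae ?_
        filter_upwards [hεpol] with ω h
        rw [max_eq_right h, div_mul_cancel₀ _ (by linarith : pol n ω a ≠ 0)]

lemma mgf_bound
    {Ω 𝒜 : Type*} [MeasurableSpace Ω] [Fintype 𝒜] [DecidableEq 𝒜]
    [MeasurableSpace 𝒜] [MeasurableSingletonClass 𝒜]
    (P : Measure Ω) [IsProbabilityMeasure P]
    (t : ℕ)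
    (A : ℕ → Ω → 𝒜) (R : ℕ → Ω → ℝ)
    (hA : ∀ n, Measurable (A n)) (hR : ∀ n, Measurable (R n))
    (hR01 : ∀ n ω, R n ω ∈ Set.Icc (0 : ℝ) 1)
    (pol : ℕ → Ω → 𝒜 → ℝ)
    (hpolMeas : ∀ n a, Measurable[hist A R (n - 1)] (fun ω => pol n ω a))
    (hpolCond : ∀ n, 1 ≤ n → n ≤ t → ∀ a : 𝒜,
      (P[(fun ω => if A n ω = a then (1 : ℝ) else 0) | hist A R (n - 1)])
        =ᵐ[P] fun ω => pol n ω a)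
    (rbar : 𝒜 → ℝ) (hrbar : ∀ a, rbar a ∈ Set.Icc (0 : ℝ) 1)
    (hrew : ∀ n, 1 ≤ n → n ≤ t →
      (P[R n | hist A R (n - 1) ⊔ MeasurableSpace.comap (A n) inferInstance])
        =ᵐ[P] fun ω => rbar (A n ω))
    (ε : ℝ) (hε0 : 0 < ε) (hε1 : ε ≤ 1)
    (hεpol : ∀ n, 1 ≤ n → n ≤ t → ∀ a : 𝒜, ∀ᵐ ω ∂P, ε ≤ pol n ω a)
    (s : ℝ) (hs : 0 ≤ s) (a : 𝒜) (k : ℕ) (hk : k ≤ t) :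
    Measurable[hist A R k] (fun ω => Real.exp (s * ∑ n ∈ Finset.Icc 1 k, Xtr A R pol ε a n ω)) ∧
    (∀ ω, |Real.exp (s * ∑ n ∈ Finset.Icc 1 k, Xtr A R pol ε a n ω)| ≤ Real.exp (s * (k * ε⁻¹))) ∧
    ∫ ω, Real.exp (s * ∑ n ∈ Finset.Icc 1 k, Xtr A R pol ε a n ω) ∂P
      ≤ Real.exp (k * (s * rbar a + s ^ 2 / (8 * ε ^ 2))) := by
  have hm : ∀ k, Measurable[hist A R k]
      (fun ω => Real.exp (s * ∑ n ∈ Finset.Icc 1 k, Xtr A R pol ε a n ω)) := by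
    intro k
    have h1 := fun n (hn : n ∈ Finset.Icc 1 k) =>
      Xtr_meas A R pol ε hpolMeas a n k (Finset.mem_Icc.1 hn).1 (Finset.mem_Icc.1 hn).2
    letI := hist A R k
    exact Real.measurable_exp.comp ((Finset.measurable_fun_sum _ h1).const_mul s)
  have hb : ∀ k : ℕ, ∀ ω, |Real.exp (s * ∑ n ∈ Finset.Icc 1 k, Xtr A R pol ε a n ω)|
      ≤ Real.exp (s * (k * ε⁻¹)) := by
    intro k ω
    rw [abs_of_pos (Real.exp_pos _)]
    gcongr
    have := Finset.sum_le_card_nsmul (Finset.Icc 1 k) (fun n => Xtr A R pol ε a n ω) ε⁻¹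
      (fun n _ => Xtr_le A R pol ε hε0 hR01 a n ω)
    simpa using this
  refine ⟨hm k, hb k, ?_⟩
  induction k with
  | zero => simp
  | succ k ih =>
    have ih := ih (by omega)
    set W := fun ω => Real.exp (s * ∑ n ∈ Finset.Icc 1 k, Xtr A R pol ε a n ω) with hWdef
    have hWi : Integrable W P := Integrable.of_bound
      ((hm k).mono (hist_le A R hA hR k) le_rfl).aestronglyMeasurable _
      (Filter.Eventually.of_forall (hb k))
    have hXm : Measurable (Xtr A R pol ε a (k + 1)) :=
      (Xtr_meas A R pol ε hpolMeas a (k + 1) (k + 1) (by omega) le_rfl).mono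
        (hist_le A R hA hR (k + 1)) le_rfl
    have hX0 := fun ω => Xtr_nonneg A R pol ε hε0 hR01 a (k + 1) ω
    have hX1 := fun ω => Xtr_le A R pol ε hε0 hR01 a (k + 1) ω
    have hWX : Integrable (fun ω => W ω * Xtr A R pol ε a (k + 1) ω) P :=
      hWi.mul_bdd (c := ε⁻¹) hXm.aestronglyMeasurable
        (Filter.Eventually.of_forall fun ω => by
          rw [Real.norm_eq_abs, abs_of_nonneg (hX0 ω)]; exact hX1 ω)
    have hstep := one_step P A R hA hR hR01 pol hpolMeas (k + 1) a
      (hpolCond _ (by omega) hk a) rbar (hrew _ (by omega) hk) ε hε0 (hεpol _ (by omega) hk a)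
      W (hm k) _ (hb k)
    set c := ε * (Real.exp (s / ε) - 1) with hc
    have hsplit : ∀ ω, Real.exp (s * ∑ n ∈ Finset.Icc 1 (k + 1), Xtr A R pol ε a n ω)
        = W ω * Real.exp (s * Xtr A R pol ε a (k + 1) ω) := by
      intro ω
      rw [Finset.sum_Icc_succ_top (by omega), mul_add, Real.exp_add]
    have hW0 : 0 ≤ ∫ ω, W ω ∂P := integral_nonneg fun ω => (Real.exp_pos _).le
    have hbern := bern_hoeffding (ε * rbar a) (s / ε) (mul_nonneg hε0.le (hrbar a).1)
      (mul_le_one₀ hε1 (hrbar a).1 (hrbar a).2)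
    have e1 : s / ε * (ε * rbar a) + (s / ε) ^ 2 / 8 = s * rbar a + s ^ 2 / (8 * ε ^ 2) := by
      field_simp
    rw [e1] at hbern
    calc ∫ ω, Real.exp (s * ∑ n ∈ Finset.Icc 1 (k + 1), Xtr A R pol ε a n ω) ∂P
        ≤ ∫ ω, (W ω + c * (W ω * Xtr A R pol ε a (k + 1) ω)) ∂P := by
          refine integral_mono_of_nonneg (Filter.Eventually.of_forall fun ω => (Real.exp_pos _).le)
            (hWi.add (hWX.const_mul c)) (Filter.Eventually.of_forall fun ω => ?_)
          simp only [hsplit]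
          have h := chord ε s _ hε0 (hX0 ω) (hX1 ω)
          have := mul_le_mul_of_nonneg_left h (Real.exp_pos (s * ∑ n ∈ Finset.Icc 1 k, Xtr A R pol ε a n ω)).le
          calc _ ≤ _ := this
            _ = _ := by simp only [hWdef, hc]; ring
      _ = (∫ ω, W ω ∂P) * (1 - ε * rbar a + ε * rbar a * Real.exp (s / ε)) := by
          rw [integral_add hWi (hWX.const_mul c), integral_const_mul, hstep, hc]; ring
      _ ≤ Real.exp (k * (s * rbar a + s ^ 2 / (8 * ε ^ 2))) *
            Real.exp (s * rbar a + s ^ 2 / (8 * ε ^ 2)) := by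
          refine mul_le_mul ih hbern ?_ (Real.exp_pos _).le
          have h1 : ε * rbar a ≤ 1 := mul_le_one₀ hε1 (hrbar a).1 (hrbar a).2
          have h2 := mul_nonneg hε0.le (hrbar a).1
          have := Real.exp_pos (s / ε)
          nlinarith [mul_nonneg h2 this.le]
      _ = _ := by rw [← Real.exp_add]; push_cast; ring_nf

/-- **One-sided Hoeffding PAC-Bayes inequality**: with probability at least `1 − δ`,
simultaneously for all policies `π`,
`r̂^IS(π, H^t) − r̄(π) ≤ (KL(π‖μ) + ln(1/δ))/λ + λ/(8 t ε²)`. -/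
theorem one_sided_hoeffding_pac_bayes
    {Ω 𝒜 : Type*} [MeasurableSpace Ω] [Fintype 𝒜] [DecidableEq 𝒜]
    [MeasurableSpace 𝒜] [MeasurableSingletonClass 𝒜]
    (P : Measure Ω) [IsProbabilityMeasure P]
    -- the horizon
    (t : ℕ) (ht : 1 ≤ t)
    -- the action and reward processes
    (A : ℕ → Ω → 𝒜) (R : ℕ → Ω → ℝ)
    (hA : ∀ n, Measurable (A n)) (hR : ∀ n, Measurable (R n))
    (hR01 : ∀ n ω, R n ω ∈ Set.Icc (0 : ℝ) 1)
    -- the logging policies: `ℱ_{n-1}`-measurable pmfs on `𝒜`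
    (pol : ℕ → Ω → 𝒜 → ℝ)
    (hpolPMF : ∀ n ω, IsPMF (pol n ω))
    (hpolMeas : ∀ n a, Measurable[hist A R (n - 1)] (fun ω => pol n ω a))
    -- the conditional distribution of `A_n` given `ℱ_{n-1}` is `π_n`
    (hpolCond : ∀ n, 1 ≤ n → n ≤ t → ∀ a : 𝒜,
      (P[(fun ω => if A n ω = a then (1 : ℝ) else 0) | hist A R (n - 1)])
        =ᵐ[P] fun ω => pol n ω a)
    -- the mean-reward function: `E[R_n | ℱ_{n-1}, A_n] = r̄(A_n)`
    (rbar : 𝒜 → ℝ) (hrbar : ∀ a, rbar a ∈ Set.Icc (0 : ℝ) 1)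
    (hrew : ∀ n, 1 ≤ n → n ≤ t →
      (P[R n | hist A R (n - 1) ⊔ MeasurableSpace.comap (A n) inferInstance])
        =ᵐ[P] fun ω => rbar (A n ω))
    -- a uniform lower bound on the logging policies
    (ε : ℝ) (hε0 : 0 < ε) (hε1 : ε ≤ 1)
    (hεpol : ∀ n, 1 ≤ n → n ≤ t → ∀ a : 𝒜, ∀ᵐ ω ∂P, ε ≤ pol n ω a)
    -- the prior policy
    (μ : 𝒜 → ℝ) (hμ : IsPMF μ)
    -- the parameters
    (l : ℝ) (hl : 0 < l) (δ : ℝ) (hδ : δ ∈ Set.Ioo (0 : ℝ) 1) :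
    (P {ω | ∀ p : 𝒜 → ℝ, IsPMF p → (∀ a, μ a = 0 → p a = 0) →
        rISPol A R pol t p ω - rPol rbar p ≤
          (KL p μ + Real.log (1 / δ)) / l + l / (8 * t * ε ^ 2)}).toReal
      ≥ 1 - δ := by
  obtain ⟨hδ0, hδ1⟩ := hδ
  have htpos : (0 : ℝ) < t := by exact_mod_cast ht
  set c := l ^ 2 / (8 * t * ε ^ 2) with hc
  set s := l / t with hs
  let Y : 𝒜 → Ω → ℝ := fun a ω => Real.exp (s * ∑ n ∈ Finset.Icc 1 t, Xtr A R pol ε a n ω)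
  have hY := fun a => mgf_bound P t A R hA hR hR01 pol hpolMeas hpolCond rbar hrbar hrew ε hε0 hε1
    hεpol s (by positivity) a t le_rfl
  have hYm : ∀ a, Measurable (Y a) := fun a => (hY a).1.mono (hist_le A R hA hR t) le_rfl
  have hYi : ∀ a, Integrable (Y a) P := fun a => Integrable.of_bound
    (hYm a).aestronglyMeasurable _ (Filter.Eventually.of_forall (hY a).2.1)
  let S : Ω → ℝ := fun ω => ∑ a, μ a * (Real.exp (-(l * rbar a)) * Y a ω)
  have hSm : Measurable S := Finset.measurable_fun_sum _ fun a _ =>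
    ((hYm a).const_mul _).const_mul _
  have hSi : Integrable S P := integrable_finsetSum _ fun a _ =>
    ((hYi a).const_mul _).const_mul _
  have hS0 : ∀ ω, 0 ≤ S ω := fun ω => Finset.sum_nonneg fun a _ =>
    mul_nonneg (hμ.1 a) (mul_nonneg (Real.exp_pos _).le (Real.exp_pos _).le)
  have hSint : ∫ ω, S ω ∂P ≤ Real.exp c := by
    simp only [S]
    rw [integral_finsetSum _ fun a _ => ((hYi a).const_mul _).const_mul _]
    calc _ ≤ ∑ a, μ a * Real.exp c := by
          refine Finset.sum_le_sum fun a _ => ?_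
          rw [integral_const_mul, integral_const_mul]
          refine mul_le_mul_of_nonneg_left ?_ (hμ.1 a)
          calc _ ≤ Real.exp (-(l * rbar a)) * Real.exp (t * (s * rbar a + s ^ 2 / (8 * ε ^ 2))) :=
                mul_le_mul_of_nonneg_left (hY a).2.2 (Real.exp_pos _).le
            _ = _ := by
                rw [← Real.exp_add, hs, hc]
                congr 1
                field_simp
                ring
      _ = _ := by rw [← Finset.sum_mul, hμ.2, one_mul]
  have hmarkov := mul_meas_ge_le_integral_of_nonneg (μ := P) (Filter.Eventually.of_forall hS0) hSi
    (Real.exp c / δ)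
  have hbad : P.real {ω | Real.exp c / δ ≤ S ω} ≤ δ := by
    have hx := Real.exp_pos c
    have h := hmarkov.trans hSint
    rw [div_mul_eq_mul_div, div_le_iff₀ hδ0] at h
    exact le_of_mul_le_mul_left h hx
  have hgood : 1 - δ ≤ P.real {ω | Real.exp c / δ ≤ S ω}ᶜ := by
    rw [probReal_compl_eq_one_sub (measurableSet_le measurable_const hSm)]
    linarith
  have hae : ∀ᵐ ω ∂P, ∀ n, n ∈ Finset.Icc 1 t → ∀ a, ε ≤ pol n ω a := by
    rw [ae_all_iff]; intro n
    rw [Filter.eventually_imp_distrib_left]; intro hn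
    rw [ae_all_iff]; intro a
    exact hεpol n (Finset.mem_Icc.1 hn).1 (Finset.mem_Icc.1 hn).2 a
  refine ge_iff_le.2 (hgood.trans ?_)
  refine ENNReal.toReal_mono (measure_ne_top _ _) (measure_mono_ae ?_)
  filter_upwards [hae] with ω hω hG
  have hG' : S ω < Real.exp c / δ := not_le.1 hG
  intro p hp hac
  have hX : ∀ a, rIS A R pol t a ω = (t : ℝ)⁻¹ * ∑ n ∈ Finset.Icc 1 t, Xtr A R pol ε a n ω := by
    intro a
    unfold rIS Xtr
    congr 1
    refine Finset.sum_congr rfl fun n hn => ?_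
    by_cases h : A n ω = a
    · rw [if_pos h, h, max_eq_right (hω n hn a)]
    · simp [h]
  have hD := donsker p μ (fun a => l * (rIS A R pol t a ω - rbar a)) hp hμ hac
  have hSe : ∑ a, μ a * Real.exp (l * (rIS A R pol t a ω - rbar a)) = S ω := by
    refine Finset.sum_congr rfl fun a _ => ?_
    simp only [Y]
    rw [← Real.exp_add, hX a, hs]
    congr 2
    ring
  rw [hSe] at hD
  have hlog : Real.log (S ω) ≤ c + Real.log (1 / δ) := by
    have hb : 0 ≤ c + Real.log (1 / δ) := by
      have := Real.log_nonneg (one_le_one_div hδ0 hδ1.le)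
      positivity
    rcases (hS0 ω).lt_or_eq with h | h
    · have := Real.log_le_log h hG'.le
      rw [Real.log_div (Real.exp_pos c).ne' hδ0.ne', Real.log_exp] at this
      simpa [sub_eq_add_neg] using this
    · rw [← h]; simpa using hb
  have hlhs : ∑ a, p a * (l * (rIS A R pol t a ω - rbar a))
      = l * (rISPol A R pol t p ω - rPol rbar p) := by
    unfold rISPol rPol
    rw [← Finset.sum_sub_distrib, Finset.mul_sum]
    exact Finset.sum_congr rfl fun a _ => by ring
  rw [hlhs] at hD
  have hfin : l * (rISPol A R pol t p ω - rPol rbar p)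
      ≤ l * ((KL p μ + Real.log (1 / δ)) / l + l / (8 * t * ε ^ 2)) := by
    have e : l * ((KL p μ + Real.log (1 / δ)) / l + l / (8 * t * ε ^ 2))
        = KL p μ + Real.log (1 / δ) + c := by
      rw [hc]; field_simp
    rw [e]; linarith
  exact le_of_mul_le_mul_left hfin hl

end OfflineBandits
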